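/- arXiv:math/0408039 — 4 statements merged into one kernel-verified Lean document; each statement's English description precedes it below -/
import Mathlib

section
/- If X is a compact Hausdorff scattered topological space, then there is no independent ω-sequence of clopen subsets of X; that is, there are no clopen sets K_i ⊆ X (i < ω) such that ⋂_{i<n} K_i^{s(i)} ≠ ∅ for every n < ω and every s : n → {0,1}. -/
open Set

/-- The set of points of `A` that are isolated in the subspace `A`. -/
def isolatedIn {X : Type*} [TopologicalSpace X] (A : Set X) : Set X :=
  {x | x ∈ A ∧ ∃ U : Set X, IsOpen U ∧ U ∩ A = {x}}

/-- A space is scattered iff every nonempty subset has a point isolated in it. -/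
def Scattered (X : Type*) [TopologicalSpace X] : Prop :=
  ∀ A : Set X, A.Nonempty → (isolatedIn A).Nonempty

/-- `piece K b` is `K` if `b = false` and the complement of `K` if `b = true`. -/
def piece {D : Type*} (K : Set D) (b : Bool) : Set D := if b then Kᶜ else K

/-- Independence for an `ω`-sequence of subsets. -/
def IndepSeq {D : Type*} (K : ℕ → Set D) : Prop :=
  ∀ (n : ℕ) (s : Fin n → Bool), (⋂ i : Fin n, piece (K i) (s i)).Nonempty

/-- Independence for a finite sequence of subsets. -/
def IndepFin {D : Type*} {n : ℕ} (K : Fin n → Set D) : Prop :=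
  ∀ (m : ℕ) (hm : m ≤ n) (s : Fin m → Bool),
    (⋂ i : Fin m, piece (K (Fin.castLE hm i)) (s i)).Nonempty

/-- Independence for a list of subsets. -/
def IndepList {D : Type*} (L : List (Set D)) : Prop :=
  IndepFin (fun i : Fin L.length => L.get i)

/-- A subalgebra of the power set: contains the whole set and is closed under
complements and finite unions. -/
def IsSubalgebra {D : Type*} (A : Set (Set D)) : Prop :=
  Set.univ ∈ A ∧ (∀ s ∈ A, sᶜ ∈ A) ∧ (∀ s ∈ A, ∀ t ∈ A, s ∪ t ∈ A)

/-- `A` separates the points of `E`. -/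
def SeparatesPts {D : Type*} (A : Set (Set D)) (E : Set D) : Prop :=
  ∀ a ∈ E, ∀ b ∈ E, a ≠ b → ∃ H ∈ A, a ∈ H ∧ b ∉ H

/-- Nodes of the tree `T(⟨C ξ : ξ < γ⟩)`. -/
structure TNode (D : Type*) (γ : Ordinal) (C : Ordinal → Set (Set D)) where
  xs : List Ordinal
  hs : List (Set D)
  len_eq : xs.length = hs.length
  nodup : xs.Nodup
  lt : ∀ ξ ∈ xs, ξ < γ
  mem : ∀ i : Fin xs.length, hs.get (Fin.cast len_eq i) ∈ C (xs.get i)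
  indep : IndepList hs

/-- `TExt y x` : `y` is a proper extension of `x` in the tree (so `y` lies
strictly below `x`, the root `(∅,∅)` being the top). -/
def TExt {D : Type*} {γ : Ordinal} {C : Ordinal → Set (Set D)}
    (y x : TNode D γ C) : Prop :=
  x.xs <+: y.xs ∧ x.hs <+: y.hs ∧ x.xs.length < y.xs.length

/-- Ordinal–indexed Cantor–Bendixson derivatives. -/
noncomputable def CBD (X : Type*) [TopologicalSpace X] : Ordinal → Set X := fun o =>
  o.limitRecOn Set.univ (fun _ S => S \ isolatedIn S)
    (fun o _ ih => ⋂ p : {o' : Ordinal // o' < o}, ih p p.2)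

/-- The Cantor–Bendixson height: the least `α` with `CBD X α = ∅`. -/
noncomputable def hgt (X : Type*) [TopologicalSpace X] : Ordinal :=
  sInf {α : Ordinal | CBD X α = ∅}

theorem not_isOpen_singleton_natBool (x : ℕ → Bool) : ¬ IsOpen ({x} : Set (ℕ → Bool)) := by
  intro h
  have hlim : Filter.Tendsto (fun n => Function.update x n (!x n)) Filter.atTop (nhds x) := by
    refine tendsto_pi_nhds.2 fun i => tendsto_const_nhds.congr' ?_
    filter_upwards [Filter.eventually_gt_atTop i] with n hn
    rw [Function.update_of_ne hn.ne]
  obtain ⟨n, hn⟩ := (hlim.eventually_mem (h.mem_nhds rfl)).exists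
  have := congrFun (Set.mem_singleton_iff.1 hn) n
  simp at this

/-- A compact scattered space admits no continuous surjection onto a Hausdorff space
without isolated points. -/
theorem Scattered.not_surjective.{u} {X Y : Type u} [TopologicalSpace X] [CompactSpace X]
    (hX : Scattered X) [TopologicalSpace Y] [T2Space Y] [Nonempty Y]
    (hY : ∀ y : Y, ¬ IsOpen ({y} : Set Y)) {f : X → Y} (hf : Continuous f) :
    ¬ f.Surjective := by
  intro hsurj
  obtain ⟨E, hE, hEuniv, hmin⟩ := exists_compact_surjective_zorn_subset hf hsurj
  have hne : E.Nonempty := by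
    rw [← Set.image_nonempty (f := f), hEuniv]
    exact Set.univ_nonempty
  obtain ⟨x, hxE, U, hU, hUE⟩ := hX E hne
  have hxU : x ∈ U := (hUE.symm ▸ Set.mem_singleton x : x ∈ U ∩ E).1
  have hclosed : IsClosed ((↑) ⁻¹' Uᶜ : Set E) := hU.isClosed_compl.preimage continuous_subtype_val
  refine hmin _ (fun h => ?_) hclosed ?_
  · exact (h.symm ▸ Set.mem_univ (⟨x, hxE⟩ : E) : (⟨x, hxE⟩ : E) ∈ ((↑) ⁻¹' Uᶜ : Set E)) hxU
  · have himage := (hclosed.isCompact.image hf.continuousOn.domRestrict).isClosed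
    have hsub : {f x}ᶜ ⊆ E.domRestrict f '' ((↑) ⁻¹' Uᶜ) := by
      intro y hy
      obtain ⟨z, hzE, rfl⟩ : y ∈ f '' E := hEuniv ▸ Set.mem_univ y
      refine ⟨⟨z, hzE⟩, fun hzU => hy ?_, rfl⟩
      rw [Set.mem_singleton_iff.1 (hUE ▸ ⟨hzU, hzE⟩ : z ∈ ({x} : Set X))]
      rfl
    have hdense : Dense ({f x}ᶜ : Set Y) := dense_compl_singleton_iff_not_open.2 (hY _)
    rw [← himage.closure_eq]
    exact (hdense.mono hsub).closure_eq

theorem IsClopen.piece {X : Type*} [TopologicalSpace X] {K : Set X} (hK : IsClopen K)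
    (b : Bool) : IsClopen (piece K b) := by
  cases b
  · simpa [_root_.piece] using hK
  · simpa [_root_.piece] using hK.compl

theorem mem_piece_iff {D : Type*} {K : Set D} {b : Bool} {x : D} :
    x ∈ piece K b ↔ Kᶜ.boolIndicator x = b := by
  by_cases hx : x ∈ K <;> cases b <;> simp [piece, Set.boolIndicator, hx]

theorem IndepSeq.iInter_piece_nonempty {X : Type*} [TopologicalSpace X] [CompactSpace X]
    {K : ℕ → Set X} (hK : ∀ i, IsClopen (K i)) (hind : IndepSeq K) (s : ℕ → Bool) :
    (⋂ i, piece (K i) (s i)).Nonempty := by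
  have hclosed (n : ℕ) : IsClosed (⋂ i : Fin n, piece (K i) (s i)) :=
    isClosed_iInter fun i => ((hK i).piece _).isClosed
  obtain ⟨x, hx⟩ := IsCompact.nonempty_iInter_of_sequence_nonempty_isCompact_isClosed
    (fun n => ⋂ i : Fin n, piece (K i) (s i))
    (fun n => Set.subset_iInter fun i => Set.iInter_subset_of_subset i.castSucc subset_rfl)
    (fun n => hind n fun i => s i) (hclosed 0).isCompact hclosed
  exact ⟨x, Set.mem_iInter.2 fun i =>
    Set.mem_iInter.1 (Set.mem_iInter.1 hx (i + 1)) (Fin.last i)⟩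

/-- a compact Hausdorff scattered space admits no independent
ω-sequence of clopen subsets. -/
theorem stmt_0 {X : Type*} [TopologicalSpace X] [CompactSpace X] [T2Space X]
    (hX : Scattered X) :
    ¬ ∃ K : ℕ → Set X, (∀ i, IsClopen (K i)) ∧ IndepSeq K := by
  rintro ⟨K, hK, hind⟩
  have hf : Continuous fun x : X => ULift.up fun i : ℕ => (K i)ᶜ.boolIndicator x :=
    continuous_uliftUp.comp <|
      continuous_pi fun i => (continuous_boolIndicator_iff_isClopen _).2 (hK i).compl
  refine hX.not_surjective (fun y hy => not_isOpen_singleton_natBool y.down ?_) hf fun s => ?_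
  · simpa [Set.preimage, ULift.ext_iff] using hy.preimage continuous_uliftUp
  obtain ⟨x, hx⟩ := hind.iInter_piece_nonempty hK s.down
  exact ⟨x, ULift.ext _ _ <| funext fun i => mem_piece_iff.1 (Set.mem_iInter.1 hx i)⟩
end

section
/- Let X be a Hausdorff topological space, let E and F be disjoint subsets of X with F contained in the closure of E, and let B be a subalgebra of the clopen subsets of X separating the points of E. Suppose ⟨H_0,…,H_{n-1}⟩ is an independent sequence of clopen subsets of X such that F ∩ ⋂_{i<n} H_i^{s(i)} ≠ ∅ for every s : n → {0,1}. Then there exists H_n ∈ B such that ⟨H_0,…,H_{n-1},H_n⟩ is independent and moreover E ∩ ⋂_{i≤n} H_i^{s(i)} ≠ ∅ for every s : (n+1) → {0,1}. -/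
open Set

theorem eq_of_mem_piece {D : Type*} {K : Set D} {x : D} {b c : Bool}
    (hb : x ∈ piece K b) (hc : x ∈ piece K c) : b = c := by
  cases b <;> cases c <;> simp_all [piece]

theorem IsSubalgebra.inter_mem {D : Type*} {B : Set (Set D)} (hB : IsSubalgebra B)
    {s t : Set D} (hs : s ∈ B) (ht : t ∈ B) : s ∩ t ∈ B := by
  rw [← compl_compl (s ∩ t), compl_inter]
  exact hB.2.1 _ (hB.2.2 _ (hB.2.1 _ hs) _ (hB.2.1 _ ht))

theorem IsSubalgebra.empty_mem {D : Type*} {B : Set (Set D)} (hB : IsSubalgebra B) :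
    ∅ ∈ B := by
  simpa using hB.2.1 _ hB.1

theorem IsSubalgebra.exists_separating_of_finite {D : Type*} {B : Set (Set D)}
    (hB : IsSubalgebra B) {S T : Set D} (hS : S.Finite) (hT : T.Finite)
    (h : ∀ a ∈ S, ∀ b ∈ T, ∃ K ∈ B, a ∈ K ∧ b ∉ K) :
    ∃ K ∈ B, S ⊆ K ∧ Disjoint T K := by
  have point : ∀ a ∈ S, ∃ K ∈ B, a ∈ K ∧ Disjoint T K := by
    intro a ha
    have hab : ∀ b ∈ T, ∃ K ∈ B, a ∈ K ∧ b ∉ K := h a ha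
    clear h
    induction T, hT using Set.Finite.induction_on with
    | empty => exact ⟨univ, hB.1, mem_univ a, empty_disjoint _⟩
    | @insert b T _ _ ih =>
      obtain ⟨K, hK, haK, hTK⟩ := ih fun c hc => hab c (mem_insert_of_mem b hc)
      obtain ⟨L, hL, haL, hbL⟩ := hab b (mem_insert b T)
      refine ⟨K ∩ L, hB.inter_mem hK hL, ⟨haK, haL⟩, ?_⟩
      rw [disjoint_insert_left]
      exact ⟨fun hb => hbL hb.2, hTK.mono_right inter_subset_left⟩
  clear h
  induction S, hS using Set.Finite.induction_on with
  | empty => exact ⟨∅, hB.empty_mem, Subset.rfl, disjoint_empty _⟩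
  | @insert a S _ _ ih =>
    obtain ⟨K, hK, hSK, hTK⟩ := ih fun c hc => point c (mem_insert_of_mem a hc)
    obtain ⟨L, hL, haL, hTL⟩ := point a (mem_insert a S)
    exact ⟨K ∪ L, hB.2.2 _ hK _ hL,
      insert_subset (Or.inr haL) (hSK.trans subset_union_left), hTK.union_right hTL⟩

theorem nontrivial_inter_of_mem_closure {X : Type*} [TopologicalSpace X] [T1Space X]
    {E U : Set X} (hU : IsOpen U) {x : X} (hxU : x ∈ U) (hxE : x ∈ closure E)
    (hx : x ∉ E) : (E ∩ U).Nontrivial := by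
  obtain ⟨a, haU, haE⟩ := mem_closure_iff.1 hxE U hU hxU
  have hxa : x ≠ a := fun h => hx (h ▸ haE)
  obtain ⟨b, ⟨hbU, hba⟩, hbE⟩ :=
    mem_closure_iff.1 hxE (U \ {a}) (hU.sdiff isClosed_singleton) ⟨hxU, hxa⟩
  exact ⟨a, ⟨haE, haU⟩, b, ⟨hbE, hbU⟩, fun h => hba h.symm⟩

theorem IndepFin.of_nonempty_iInter {D : Type*} {n : ℕ} {K : Fin n → Set D}
    (h : ∀ s : Fin n → Bool, (⋂ i, piece (K i) (s i)).Nonempty) : IndepFin K := by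
  intro m hm s
  obtain ⟨x, hx⟩ := h fun i => if hi : (i : ℕ) < m then s ⟨i, hi⟩ else false
  refine ⟨x, mem_iInter.2 fun i => ?_⟩
  simpa using mem_iInter.1 hx (Fin.castLE hm i)

/-- extending an independent sequence of clopen sets by an element
of an algebra separating the points of E. -/
theorem stmt_7 {X : Type*} [TopologicalSpace X] [T2Space X]
    (E F : Set X) (hdisj : Disjoint E F) (hFE : F ⊆ closure E)
    (B : Set (Set X)) (hBclopen : ∀ A ∈ B, IsClopen A)
    (hBalg : IsSubalgebra B) (hBsep : SeparatesPts B E)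
    (n : ℕ) (H : Fin n → Set X) (hH : ∀ i, IsClopen (H i))
    (hind : IndepFin H)
    (hF : ∀ s : Fin n → Bool,
      (F ∩ ⋂ i : Fin n, piece (H i) (s i)).Nonempty) :
    ∃ Hn ∈ B, IndepFin (Fin.snoc H Hn : Fin (n + 1) → Set X) ∧
      ∀ s : Fin (n + 1) → Bool,
        (E ∩ ⋂ i : Fin (n + 1),
          piece ((Fin.snoc H Hn : Fin (n + 1) → Set X) i) (s i)).Nonempty := by
  have nontriv : ∀ s : Fin n → Bool, (E ∩ ⋂ i, piece (H i) (s i)).Nontrivial := by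
    intro s
    obtain ⟨x, hxF, hx⟩ := hF s
    exact nontrivial_inter_of_mem_closure
      (isOpen_iInter_of_finite fun i => ((hH i).piece (s i)).isOpen) hx (hFE hxF)
      fun hxE => hdisj.notMem_of_mem_left hxE hxF
  choose a ha b hb hab using nontriv
  obtain ⟨K, hK, haK, hbK⟩ : ∃ K ∈ B, range a ⊆ K ∧ Disjoint (range b) K := by
    refine hBalg.exists_separating_of_finite (finite_range a) (finite_range b) ?_
    rintro _ ⟨s, rfl⟩ _ ⟨t, rfl⟩
    refine hBsep _ (ha s).1 _ (hb t).1 fun hst => ?_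
    have h_eq : s = t := funext fun i =>
      eq_of_mem_piece (mem_iInter.1 (ha s).2 i) (hst ▸ mem_iInter.1 (hb t).2 i)
    exact hab s (h_eq ▸ hst)
  have meets : ∀ s : Fin (n + 1) → Bool,
      (E ∩ ⋂ i : Fin (n + 1),
        piece ((Fin.snoc H K : Fin (n + 1) → Set X) i) (s i)).Nonempty := by
    intro s
    let t : Fin n → Bool := fun i => s i.castSucc
    cases hs : s (Fin.last n)
    · refine ⟨a t, (ha t).1, mem_iInter.2 (Fin.lastCases ?_ fun i => ?_)⟩
      · simpa [hs, piece] using haK (mem_range_self t)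
      · simpa using mem_iInter.1 (ha t).2 i
    · refine ⟨b t, (hb t).1, mem_iInter.2 (Fin.lastCases ?_ fun i => ?_)⟩
      · simpa [hs, piece] using hbK.notMem_of_mem_left (mem_range_self t)
      · simpa using mem_iInter.1 (hb t).2 i
  exact ⟨K, hK, .of_nonempty_iInter fun s => (meets s).mono inter_subset_right, meets⟩
end

section
/- Let A be a subalgebra of the power set of a set X (a family of subsets of X containing X and closed under complements and finite unions) which separates the points of a set E ⊆ X, i.e., for distinct a, b ∈ E there is A ∈ A with a ∈ A and b ∉ A. If F_1, …, F_m are pairwise disjoint subsets of E, each containing at least two elements, then there exists H ∈ A such that H ∩ F_j ≠ ∅ and F_j ∖ H ≠ ∅ for every j = 1, …, m. -/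
open Set

namespace IsSubalgebra

variable {X ι : Type*} {A : Set (Set X)}

theorem inter_mem_s8 (hA : IsSubalgebra A) {s t : Set X} (hs : s ∈ A) (ht : t ∈ A) :
    s ∩ t ∈ A := by
  have h := hA.2.1 _ (hA.2.2 _ (hA.2.1 s hs) _ (hA.2.1 t ht))
  rwa [← compl_inter, compl_compl] at h

theorem iUnion_mem [Finite ι] (hA : IsSubalgebra A) {s : ι → Set X} (hs : ∀ i, s i ∈ A) :
    ⋃ i, s i ∈ A := by
  have := Fintype.ofFinite ι
  rw [← iSup_eq_iUnion, ← Finset.sup_univ_eq_iSup]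
  exact Finset.sup_induction (by simpa using hA.2.1 _ hA.1) hA.2.2 fun i _ => hs i

theorem iInter_mem [Finite ι] (hA : IsSubalgebra A) {s : ι → Set X} (hs : ∀ i, s i ∈ A) :
    ⋂ i, s i ∈ A := by
  have := Fintype.ofFinite ι
  rw [← iInf_eq_iInter, ← Finset.inf_univ_eq_iInf]
  exact Finset.inf_induction hA.1 (fun _ hs _ ht => hA.inter_mem_s8 hs ht) fun i _ => hs i

/-- A subalgebra separating the points of `E` separates disjoint finite families in `E`. -/
theorem exists_mem_forall_mem_forall_notMem {κ : Type*} [Finite ι] [Finite κ]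
    (hA : IsSubalgebra A) {E : Set X} (hsep : SeparatesPts A E) {a : ι → X} {b : κ → X}
    (ha : ∀ i, a i ∈ E) (hb : ∀ k, b k ∈ E) (hab : ∀ i k, a i ≠ b k) :
    ∃ H ∈ A, (∀ i, a i ∈ H) ∧ ∀ k, b k ∉ H := by
  choose H hHA haH hbH using fun i k => hsep (a i) (ha i) (b k) (hb k) (hab i k)
  refine ⟨⋃ i, ⋂ k, H i k, hA.iUnion_mem fun i => hA.iInter_mem (hHA i), fun i => ?_,
    fun k hk => ?_⟩
  · exact mem_iUnion_of_mem i (mem_iInter.2 (haH i))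
  · obtain ⟨i, hi⟩ := mem_iUnion.1 hk
    exact hbH i k (mem_iInter.1 hi k)

end IsSubalgebra

/-- an algebra of sets separating the points of E can split
finitely many pairwise disjoint subsets of E, each with at least two points,
by a single member. -/
theorem stmt_8 {X : Type*} (A : Set (Set X)) (hA : IsSubalgebra A)
    (E : Set X) (hsep : SeparatesPts A E)
    (m : ℕ) (F : Fin m → Set X)
    (hFE : ∀ j, F j ⊆ E)
    (hdisj : ∀ j k, j ≠ k → Disjoint (F j) (F k))
    (hnt : ∀ j, (F j).Nontrivial) :
    ∃ H ∈ A, ∀ j, (H ∩ F j).Nonempty ∧ (F j \ H).Nonempty := by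
  choose a ha b hb hab using hnt
  have hne : ∀ j k, a j ≠ b k := by
    intro j k h
    obtain rfl | hjk := eq_or_ne j k
    · exact hab j h
    · exact (hdisj j k hjk).ne_of_mem (ha j) (hb k) h
  obtain ⟨H, hHA, haH, hbH⟩ := hA.exists_mem_forall_mem_forall_notMem hsep
    (fun j => hFE j (ha j)) (fun k => hFE k (hb k)) hne
  exact ⟨H, hHA, fun j => ⟨⟨a j, haH j, ha j⟩, ⟨b j, hb j, hbH j⟩⟩⟩
end

section
/- If X is a compact Hausdorff scattered topological space and α is an ordinal with I(X^(α)) countable, then hgt(X) < α + (2^{ℵ0})^+. -/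
open Set

universe u

theorem CBD_add_one {X : Type*} [TopologicalSpace X] (o : Ordinal) :
    CBD X (o + 1) = CBD X o \ isolatedIn (CBD X o) :=
  Ordinal.limitRecOn_add_one ..

theorem CBD_limit {X : Type*} [TopologicalSpace X] {o : Ordinal} (ho : Order.IsSuccLimit o) :
    CBD X o = ⋂ p : {o' : Ordinal // o' < o}, CBD X p :=
  Ordinal.limitRecOn_limit _ _ _ _ ho

theorem CBD_antitone (X : Type*) [TopologicalSpace X] : Antitone (CBD X) := by
  intro a b hab
  induction b using Ordinal.limitRecOn with
  | zero => rw [nonpos_iff_eq_zero.1 hab]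
  | add_one b ih =>
    rcases hab.eq_or_lt with rfl | h
    · exact le_rfl
    · rw [CBD_add_one]
      exact sdiff_subset.trans (ih (Order.lt_add_one_iff.1 h))
  | limit b hb _ =>
    rcases hab.eq_or_lt with rfl | h
    · exact le_rfl
    · rw [CBD_limit hb]
      exact iInter_subset (fun p : {o' : Ordinal // o' < b} => CBD X p) ⟨a, h⟩

/-- In a scattered space, the isolated points of any subset are dense in it. -/
theorem Scattered.inter_subset_closure {X : Type*} [TopologicalSpace X] (hX : Scattered X)
    (A : Set X) {V : Set X} (hV : IsOpen V) :
    V ∩ A ⊆ closure (V ∩ isolatedIn A) := by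
  rintro x ⟨hxV, hxA⟩
  rw [mem_closure_iff]
  intro O hO hxO
  obtain ⟨p, ⟨⟨hpO, hpV⟩, hpA⟩, W, hW, hWp⟩ := hX (O ∩ V ∩ A) ⟨x, ⟨hxO, hxV⟩, hxA⟩
  refine ⟨p, hpO, hpV, hpA, W ∩ (O ∩ V), hW.inter (hO.inter hV), ?_⟩
  rw [← hWp, inter_assoc]

/-- The nonempty Cantor–Bendixson derivatives past stage `α` are separated by the traces of
suitable open sets on the isolated points of the `α`-th derivative. -/
theorem exists_injOn_trace_isolatedIn_CBD {X : Type*} [TopologicalSpace X] [RegularSpace X]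
    (hX : Scattered X) (α : Ordinal) :
    ∃ f : Ordinal → Set (isolatedIn (CBD X α)),
      InjOn f {β | (CBD X (α + β)).Nonempty} := by
  have key : ∀ β ∈ {β | (CBD X (α + β)).Nonempty}, ∃ (x : X) (V : Set X), IsOpen V ∧ x ∈ V ∧
      x ∈ CBD X (α + β) ∧ closure V ∩ CBD X (α + β + 1) = ∅ := by
    intro β hβ
    obtain ⟨x, hx, U, hU, hUx⟩ := hX _ hβ
    have hxU : x ∈ U := (hUx.ge (mem_singleton x)).1
    obtain ⟨C, hC, hCc, hCU⟩ := exists_mem_nhds_isClosed_subset (hU.mem_nhds hxU)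
    refine ⟨x, interior C, isOpen_interior, mem_interior_iff_mem_nhds.2 hC, hx, ?_⟩
    rw [CBD_add_one, eq_empty_iff_forall_notMem]
    rintro y ⟨hyC, hy, hyI⟩
    have hyU : y ∈ U := hCU (closure_minimal interior_subset hCc hyC)
    obtain rfl : y = x := hUx.le ⟨hyU, hy⟩
    exact hyI ⟨hy, U, hU, hUx⟩
  choose! x V hVo hxV hx hdisj using key
  refine ⟨fun β => Subtype.val ⁻¹' V β, ?_⟩
  have aux : ∀ β ∈ {β | (CBD X (α + β)).Nonempty}, ∀ γ ∈ {β | (CBD X (α + β)).Nonempty},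
      β < γ → (Subtype.val ⁻¹' V β : Set (isolatedIn (CBD X α))) ≠ Subtype.val ⁻¹' V γ := by
    intro β hβ γ hγ hlt heq
    have htrace : V γ ∩ isolatedIn (CBD X α) = V β ∩ isolatedIn (CBD X α) := by
      rw [inter_comm, inter_comm (V β)]
      exact (Subtype.preimage_val_eq_preimage_val_iff _ _ _).1 heq.symm
    have hcl : x γ hγ ∈ closure (V β) := by
      have := hX.inter_subset_closure (CBD X α) (hVo γ hγ)
        ⟨hxV γ hγ, CBD_antitone X le_self_add (hx γ hγ)⟩
      rw [htrace] at this
      exact closure_mono inter_subset_left this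
    have hsucc : x γ hγ ∈ CBD X (α + β + 1) :=
      CBD_antitone X (Order.add_one_le_of_lt ((add_lt_add_iff_left α).2 hlt)) (hx γ hγ)
    exact (hdisj β hβ).le ⟨hcl, hsucc⟩
  intro β hβ γ hγ heq
  by_contra hne
  rcases lt_or_gt_of_ne hne with h | h
  · exact aux β hβ γ hγ h heq
  · exact aux γ hγ β hβ h heq.symm

/-- if X is compact Hausdorff scattered and I(X^(α)) is
countable, then hgt X < α + (2^ℵ₀)⁺. -/
theorem stmt_18 {X : Type u} [TopologicalSpace X] [CompactSpace X] [T2Space X]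
    (hX : Scattered X) (α : Ordinal.{u})
    (hcnt : (isolatedIn (CBD X α)).Countable) :
    hgt X < α + (Order.succ Cardinal.continuum.{u}).ord := by
  by_contra! hle
  obtain ⟨f, hf⟩ := exists_injOn_trace_isolatedIn_CBD hX α
  set κ := (Order.succ Cardinal.continuum.{u}).ord
  have hne : ∀ β < κ, (CBD X (α + β)).Nonempty := fun β hβ =>
    nonempty_iff_ne_empty.2 fun h =>
      notMem_of_lt_csInf' (s := {α : Ordinal.{u} | CBD X α = ∅})
        (((add_lt_add_iff_left α).2 hβ).trans_le hle) h
  have hinj : Function.Injective fun i : κ.ToType => f (Ordinal.ToType.mk.symm i).1 := by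
    intro i j hij
    exact Ordinal.ToType.mk.symm.injective (Subtype.ext
      (hf (hne _ (Ordinal.ToType.mk.symm i).2) (hne _ (Ordinal.ToType.mk.symm j).2) hij))
  have hcard := Cardinal.mk_le_of_injective hinj
  rw [Cardinal.mk_toType, Cardinal.card_ord, Cardinal.mk_set] at hcard
  have hD : (2 : Cardinal.{u}) ^ Cardinal.mk (isolatedIn (CBD X α)) ≤ Cardinal.continuum := by
    rw [← Cardinal.two_power_aleph0]
    exact Cardinal.power_le_power_left two_ne_zero hcnt.le_aleph0
  exact (hcard.trans hD).not_gt (Order.lt_succ _)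
end
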